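/- arXiv:2503.15486 — 7 statements merged into one kernel-verified Lean document; each statement's English description precedes it below -/
import Mathlib

section
/- Suppose a trajectory (x_t)_{t=1}^{K+1}, (u^1_t, u^2_t)_{t=1}^{K}, policies, and multipliers (λ^i, ψ^i) for i = 1,2 satisfy, for both agents, the terminal condition (FB3) and the stage-K feedback conditions (FB1) and (FB2). Then λ²_K = −λ¹_K and ψ¹_K = ψ²_K = 0. -/
open Matrix

noncomputable def grad {p : ℕ} (G : (Fin p → ℝ) → ℝ) (a : Fin p → ℝ) : Fin p → ℝ :=
  fun j => fderiv ℝ G a (Pi.single j 1)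

noncomputable def jacT {p q : ℕ} (F : (Fin p → ℝ) → Fin q → ℝ) (a : Fin p → ℝ)
    (lam : Fin q → ℝ) : Fin p → ℝ :=
  fun j => lam ⬝ᵥ fderiv ℝ F a (Pi.single j 1)

theorem grad_neg {p : ℕ} (G : (Fin p → ℝ) → ℝ) (a : Fin p → ℝ) :
    grad (fun y => -(G y)) a = -grad G a := by
  funext j
  simp [grad]

theorem jacT_neg {p q : ℕ} (F : (Fin p → ℝ) → Fin q → ℝ) (a : Fin p → ℝ)
    (lam : Fin q → ℝ) : jacT F a (-lam) = -jacT F a lam := by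
  funext j
  simp [jacT]

/-- At a trajectory satisfying, for both agents, the terminal condition (FB3)
and the stage-`K` feedback conditions (FB1), (FB2), one has `λ²_K = -λ¹_K` and
`ψ¹_K = ψ²_K = 0`. -/
theorem stage_K_multipliers
    {n m1 m2 K : ℕ} (hK : 1 ≤ K)
    (f : ℕ → (Fin n → ℝ) → (Fin m1 → ℝ) → (Fin m2 → ℝ) → Fin n → ℝ)
    (l : ℕ → (Fin n → ℝ) → (Fin m1 → ℝ) → (Fin m2 → ℝ) → ℝ)
    (lf : (Fin n → ℝ) → ℝ)
    (x : ℕ → Fin n → ℝ) (u1 : ℕ → Fin m1 → ℝ) (u2 : ℕ → Fin m2 → ℝ)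
    (pi1 : ℕ → (Fin n → ℝ) → Fin m1 → ℝ) (pi2 : ℕ → (Fin n → ℝ) → Fin m2 → ℝ)
    (lam1 lam2 : ℕ → Fin n → ℝ)
    (psi1 : ℕ → Fin m2 → ℝ) (psi2 : ℕ → Fin m1 → ℝ)
    (hfd : ∀ t, 1 ≤ t → t ≤ K → Differentiable ℝ
      (fun p : (Fin n → ℝ) × (Fin m1 → ℝ) × (Fin m2 → ℝ) => f t p.1 p.2.1 p.2.2))
    (hld : ∀ t, 1 ≤ t → t ≤ K → Differentiable ℝ
      (fun p : (Fin n → ℝ) × (Fin m1 → ℝ) × (Fin m2 → ℝ) => l t p.1 p.2.1 p.2.2))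
    (hlfd : Differentiable ℝ lf)
    (hpi1d : ∀ s, 2 ≤ s → s ≤ K → Differentiable ℝ (pi1 s))
    (hpi2d : ∀ s, 2 ≤ s → s ≤ K → Differentiable ℝ (pi2 s))
    (hdyn : ∀ t, 1 ≤ t → t ≤ K → x (t+1) = f t (x t) (u1 t) (u2 t))
    (hpc1 : ∀ s, 2 ≤ s → s ≤ K → pi1 s (x s) = u1 s)
    (hpc2 : ∀ s, 2 ≤ s → s ≤ K → pi2 s (x s) = u2 s)
    (hFB3a : grad lf (x (K+1)) - lam1 K = 0)
    (hFB3b : grad (fun y => -(lf y)) (x (K+1)) - lam2 K = 0)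
    (hFB1aK : grad (fun w => l K (x K) (u1 K) w) (u2 K)
      + jacT (fun w => f K (x K) (u1 K) w) (u2 K) (lam1 K) - psi1 K = 0)
    (hFB1bK : grad (fun w => -(l K (x K) w (u2 K))) (u1 K)
      + jacT (fun w => f K (x K) w (u2 K)) (u1 K) (lam2 K) - psi2 K = 0)
    (hFB2aK : grad (fun w => l K (x K) w (u2 K)) (u1 K)
      + jacT (fun w => f K (x K) w (u2 K)) (u1 K) (lam1 K) = 0)
    (hFB2bK : grad (fun w => -(l K (x K) (u1 K) w)) (u2 K)
      + jacT (fun w => f K (x K) (u1 K) w) (u2 K) (lam2 K) = 0) :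
    lam2 K = -lam1 K ∧ psi1 K = 0 ∧ psi2 K = 0 := by
  have hlam : lam2 K = -lam1 K := by
    rw [← sub_eq_zero.mp hFB3b, ← sub_eq_zero.mp hFB3a, grad_neg]
  rw [grad_neg, hlam, jacT_neg, ← neg_add, neg_eq_zero] at hFB2bK
  rw [grad_neg, hlam, jacT_neg, ← neg_add, hFB2aK, neg_zero, zero_sub, neg_eq_zero] at hFB1bK
  rw [hFB2bK, zero_sub, neg_eq_zero] at hFB1aK
  exact ⟨hlam, hFB1aK, hFB1bK⟩
end

section
/- Fix s ∈ {2,…,K}. Suppose both agents' multipliers satisfy λ²_s = −λ¹_s together with the stage-s feedback conditions (FB1) and (FB2) for both agents. Then ψ¹_s = ψ²_s = 0. If moreover (FB4) holds at stage s for both agents, then also λ²_{s−1} = −λ¹_{s−1}. -/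
open Matrix

theorem grad_fun_neg {p : ℕ} (G : (Fin p → ℝ) → ℝ) (a : Fin p → ℝ) :
    grad (fun w => -(G w)) a = -grad G a := by
  funext j
  simp [grad, fderiv_fun_neg]

theorem jacT_zero {p q : ℕ} (F : (Fin p → ℝ) → Fin q → ℝ) (a : Fin p → ℝ) :
    jacT F a 0 = 0 := by
  funext j
  simp [jacT]

/-- Stage-`s` cascade step: if `λ²_s = -λ¹_s` and the stage-`s` feedback
conditions (FB1), (FB2) hold for both agents, then `ψ¹_s = ψ²_s = 0`; if moreover (FB4)
holds at stage `s` for both agents, then `λ²_{s-1} = -λ¹_{s-1}`. -/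
theorem cascade_step
    {n m1 m2 K : ℕ} (hK : 1 ≤ K)
    (f : ℕ → (Fin n → ℝ) → (Fin m1 → ℝ) → (Fin m2 → ℝ) → Fin n → ℝ)
    (l : ℕ → (Fin n → ℝ) → (Fin m1 → ℝ) → (Fin m2 → ℝ) → ℝ)
    (lf : (Fin n → ℝ) → ℝ)
    (x : ℕ → Fin n → ℝ) (u1 : ℕ → Fin m1 → ℝ) (u2 : ℕ → Fin m2 → ℝ)
    (pi1 : ℕ → (Fin n → ℝ) → Fin m1 → ℝ) (pi2 : ℕ → (Fin n → ℝ) → Fin m2 → ℝ)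
    (lam1 lam2 : ℕ → Fin n → ℝ)
    (psi1 : ℕ → Fin m2 → ℝ) (psi2 : ℕ → Fin m1 → ℝ)
    (hfd : ∀ t, 1 ≤ t → t ≤ K → Differentiable ℝ
      (fun p : (Fin n → ℝ) × (Fin m1 → ℝ) × (Fin m2 → ℝ) => f t p.1 p.2.1 p.2.2))
    (hld : ∀ t, 1 ≤ t → t ≤ K → Differentiable ℝ
      (fun p : (Fin n → ℝ) × (Fin m1 → ℝ) × (Fin m2 → ℝ) => l t p.1 p.2.1 p.2.2))
    (hlfd : Differentiable ℝ lf)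
    (hpi1d : ∀ s, 2 ≤ s → s ≤ K → Differentiable ℝ (pi1 s))
    (hpi2d : ∀ s, 2 ≤ s → s ≤ K → Differentiable ℝ (pi2 s))
    (hdyn : ∀ t, 1 ≤ t → t ≤ K → x (t+1) = f t (x t) (u1 t) (u2 t))
    (hpc1 : ∀ s, 2 ≤ s → s ≤ K → pi1 s (x s) = u1 s)
    (hpc2 : ∀ s, 2 ≤ s → s ≤ K → pi2 s (x s) = u2 s)
    (s : ℕ) (hs2 : 2 ≤ s) (hsK : s ≤ K)
    (hanti : lam2 s = -lam1 s)
    (hFB1as : grad (fun w => l s (x s) (u1 s) w) (u2 s)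
      + jacT (fun w => f s (x s) (u1 s) w) (u2 s) (lam1 s) - psi1 s = 0)
    (hFB1bs : grad (fun w => -(l s (x s) w (u2 s))) (u1 s)
      + jacT (fun w => f s (x s) w (u2 s)) (u1 s) (lam2 s) - psi2 s = 0)
    (hFB2as : grad (fun w => l s (x s) w (u2 s)) (u1 s)
      + jacT (fun w => f s (x s) w (u2 s)) (u1 s) (lam1 s) = 0)
    (hFB2bs : grad (fun w => -(l s (x s) (u1 s) w)) (u2 s)
      + jacT (fun w => f s (x s) (u1 s) w) (u2 s) (lam2 s) = 0) :
    psi1 s = 0 ∧ psi2 s = 0 ∧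
    ((grad (fun y => l s y (u1 s) (u2 s)) (x s) - lam1 (s-1)
        + jacT (fun y => f s y (u1 s) (u2 s)) (x s) (lam1 s)
        + jacT (pi2 s) (x s) (psi1 s) = 0) →
     (grad (fun y => -(l s y (u1 s) (u2 s))) (x s) - lam2 (s-1)
        + jacT (fun y => f s y (u1 s) (u2 s)) (x s) (lam2 s)
        + jacT (pi1 s) (x s) (psi2 s) = 0) →
     lam2 (s-1) = -lam1 (s-1)) := by
  rw [hanti, grad_fun_neg, jacT_neg] at hFB1bs hFB2bs
  have hpsi1 : psi1 s = 0 := by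
    linear_combination -hFB1as - hFB2bs
  have hpsi2 : psi2 s = 0 := by
    linear_combination -hFB1bs - hFB2as
  refine ⟨hpsi1, hpsi2, fun h1 h2 => ?_⟩
  rw [hpsi1, jacT_zero] at h1
  rw [hpsi2, jacT_zero, hanti, grad_fun_neg, jacT_neg] at h2
  linear_combination -h1 - h2
end

section
/- If a trajectory, policies, and multipliers satisfy both agents' feedback KKT systems, then the adjoint multipliers are antisymmetric, λ²_t = −λ¹_t for all t = 1,…,K, and all feedback-policy multipliers vanish, ψ¹_s = ψ²_s = 0 for all s = 2,…,K; i.e., at any local FBNE the constraints forcing the agents to play feedback policies are weakly active. -/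
open Matrix

/-- If both agents' feedback KKT systems hold, then the adjoint multipliers
are antisymmetric and all feedback-policy multipliers vanish (the feedback-policy constraints
are weakly active at any local FBNE). -/
theorem fbne_weakly_active
    {n m1 m2 K : ℕ} (hK : 1 ≤ K)
    (f : ℕ → (Fin n → ℝ) → (Fin m1 → ℝ) → (Fin m2 → ℝ) → Fin n → ℝ)
    (l : ℕ → (Fin n → ℝ) → (Fin m1 → ℝ) → (Fin m2 → ℝ) → ℝ)
    (lf : (Fin n → ℝ) → ℝ)
    (x : ℕ → Fin n → ℝ) (u1 : ℕ → Fin m1 → ℝ) (u2 : ℕ → Fin m2 → ℝ)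
    (pi1 : ℕ → (Fin n → ℝ) → Fin m1 → ℝ) (pi2 : ℕ → (Fin n → ℝ) → Fin m2 → ℝ)
    (lam1 lam2 : ℕ → Fin n → ℝ)
    (psi1 : ℕ → Fin m2 → ℝ) (psi2 : ℕ → Fin m1 → ℝ)
    (hfd : ∀ t, 1 ≤ t → t ≤ K → Differentiable ℝ
      (fun p : (Fin n → ℝ) × (Fin m1 → ℝ) × (Fin m2 → ℝ) => f t p.1 p.2.1 p.2.2))
    (hld : ∀ t, 1 ≤ t → t ≤ K → Differentiable ℝ
      (fun p : (Fin n → ℝ) × (Fin m1 → ℝ) × (Fin m2 → ℝ) => l t p.1 p.2.1 p.2.2))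
    (hlfd : Differentiable ℝ lf)
    (hpi1d : ∀ s, 2 ≤ s → s ≤ K → Differentiable ℝ (pi1 s))
    (hpi2d : ∀ s, 2 ≤ s → s ≤ K → Differentiable ℝ (pi2 s))
    (hdyn : ∀ t, 1 ≤ t → t ≤ K → x (t+1) = f t (x t) (u1 t) (u2 t))
    (hpc1 : ∀ s, 2 ≤ s → s ≤ K → pi1 s (x s) = u1 s)
    (hpc2 : ∀ s, 2 ≤ s → s ≤ K → pi2 s (x s) = u2 s)
    (hFB1a : ∀ s, 2 ≤ s → s ≤ K → grad (fun w => l s (x s) (u1 s) w) (u2 s)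
      + jacT (fun w => f s (x s) (u1 s) w) (u2 s) (lam1 s) - psi1 s = 0)
    (hFB1b : ∀ s, 2 ≤ s → s ≤ K → grad (fun w => -(l s (x s) w (u2 s))) (u1 s)
      + jacT (fun w => f s (x s) w (u2 s)) (u1 s) (lam2 s) - psi2 s = 0)
    (hFB2a : ∀ t, 1 ≤ t → t ≤ K → grad (fun w => l t (x t) w (u2 t)) (u1 t)
      + jacT (fun w => f t (x t) w (u2 t)) (u1 t) (lam1 t) = 0)
    (hFB2b : ∀ t, 1 ≤ t → t ≤ K → grad (fun w => -(l t (x t) (u1 t) w)) (u2 t)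
      + jacT (fun w => f t (x t) (u1 t) w) (u2 t) (lam2 t) = 0)
    (hFB3a : grad lf (x (K+1)) - lam1 K = 0)
    (hFB3b : grad (fun y => -(lf y)) (x (K+1)) - lam2 K = 0)
    (hFB4a : ∀ s, 2 ≤ s → s ≤ K → grad (fun y => l s y (u1 s) (u2 s)) (x s) - lam1 (s-1)
      + jacT (fun y => f s y (u1 s) (u2 s)) (x s) (lam1 s) + jacT (pi2 s) (x s) (psi1 s) = 0)
    (hFB4b : ∀ s, 2 ≤ s → s ≤ K → grad (fun y => -(l s y (u1 s) (u2 s))) (x s) - lam2 (s-1)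
      + jacT (fun y => f s y (u1 s) (u2 s)) (x s) (lam2 s) + jacT (pi1 s) (x s) (psi2 s) = 0)
 :
    (∀ t, 1 ≤ t → t ≤ K → lam2 t = -lam1 t) ∧
    (∀ s, 2 ≤ s → s ≤ K → psi1 s = 0 ∧ psi2 s = 0) := by
  simp only [grad_neg] at hFB1b hFB2b hFB3b hFB4b
  have psi_eq_zero : ∀ s, 2 ≤ s → s ≤ K → lam2 s = -lam1 s → psi1 s = 0 ∧ psi2 s = 0 := by
    intro s hs hsK hlam
    have h1a := hFB1a s hs hsK
    have h1b := hFB1b s hs hsK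
    have h2a := hFB2a s (by omega) hsK
    have h2b := hFB2b s (by omega) hsK
    rw [hlam, jacT_neg] at h1b h2b
    constructor
    · linear_combination -h1a - h2b
    · linear_combination -h1b - h2a
  have lam_antisymm : ∀ t, 1 ≤ t → t ≤ K → lam2 t = -lam1 t := by
    intro t ht htK
    induction htK using Nat.decreasingInduction with
    | self => linear_combination -hFB3a - hFB3b
    | of_succ s hsK ih =>
      have hlam := ih (by omega)
      obtain ⟨hpsi1, hpsi2⟩ := psi_eq_zero (s + 1) (by omega) hsK hlam
      have h4a := hFB4a (s + 1) (by omega) hsK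
      have h4b := hFB4b (s + 1) (by omega) hsK
      rw [hpsi1, jacT_zero, Nat.add_sub_cancel] at h4a
      rw [hpsi2, jacT_zero, hlam, jacT_neg, Nat.add_sub_cancel] at h4b
      linear_combination -h4a - h4b
  exact ⟨lam_antisymm, fun s hs hsK =>
    psi_eq_zero s hs hsK (lam_antisymm s (by omega) hsK)⟩
end

section
/- Suppose a trajectory and multipliers λ¹, λ² satisfy both agents' open-loop KKT systems. Then λ²_t = −λ¹_t for all t = 1,…,K, and for any differentiable policies π^j_s : ℝⁿ → ℝ^{m_j} with π^j_s(x_s) = u^j_s (s = 2,…,K, j = 1,2), both agents' feedback KKT systems hold with the same multipliers λ^i and with ψ^i_s = 0 for all s = 2,…,K. (Theorem 1, part 2: a local OLNE satisfies the first-order necessary conditions for a local FBNE.) -/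
open Matrix

/-- A trajectory satisfying both agents' open-loop KKT systems has
antisymmetric multipliers and, for any differentiable policies consistent with the
trajectory, satisfies both agents' feedback KKT systems with the same `λⁱ` and `ψⁱ = 0`
(Theorem 1, part 2). -/
theorem olne_implies_fbne_first_order
    {n m1 m2 K : ℕ} (hK : 1 ≤ K)
    (f : ℕ → (Fin n → ℝ) → (Fin m1 → ℝ) → (Fin m2 → ℝ) → Fin n → ℝ)
    (l : ℕ → (Fin n → ℝ) → (Fin m1 → ℝ) → (Fin m2 → ℝ) → ℝ)
    (lf : (Fin n → ℝ) → ℝ)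
    (x : ℕ → Fin n → ℝ) (u1 : ℕ → Fin m1 → ℝ) (u2 : ℕ → Fin m2 → ℝ)
    (lam1 lam2 : ℕ → Fin n → ℝ)
    (hfd : ∀ t, 1 ≤ t → t ≤ K → Differentiable ℝ
      (fun p : (Fin n → ℝ) × (Fin m1 → ℝ) × (Fin m2 → ℝ) => f t p.1 p.2.1 p.2.2))
    (hld : ∀ t, 1 ≤ t → t ≤ K → Differentiable ℝ
      (fun p : (Fin n → ℝ) × (Fin m1 → ℝ) × (Fin m2 → ℝ) => l t p.1 p.2.1 p.2.2))
    (hlfd : Differentiable ℝ lf)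
    (hdyn : ∀ t, 1 ≤ t → t ≤ K → x (t+1) = f t (x t) (u1 t) (u2 t))
    (hOL1a : ∀ t, 2 ≤ t → t ≤ K → grad (fun y => l t y (u1 t) (u2 t)) (x t)
      + jacT (fun y => f t y (u1 t) (u2 t)) (x t) (lam1 t) - lam1 (t-1) = 0)
    (hOL1b : ∀ t, 2 ≤ t → t ≤ K → grad (fun y => -(l t y (u1 t) (u2 t))) (x t)
      + jacT (fun y => f t y (u1 t) (u2 t)) (x t) (lam2 t) - lam2 (t-1) = 0)
    (hOL2a : ∀ t, 1 ≤ t → t ≤ K → grad (fun w => l t (x t) w (u2 t)) (u1 t)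
      + jacT (fun w => f t (x t) w (u2 t)) (u1 t) (lam1 t) = 0)
    (hOL2b : ∀ t, 1 ≤ t → t ≤ K → grad (fun w => -(l t (x t) (u1 t) w)) (u2 t)
      + jacT (fun w => f t (x t) (u1 t) w) (u2 t) (lam2 t) = 0)
    (hOL3a : grad lf (x (K+1)) - lam1 K = 0)
    (hOL3b : grad (fun y => -(lf y)) (x (K+1)) - lam2 K = 0)
 :
    (∀ t, 1 ≤ t → t ≤ K → lam2 t = -lam1 t) ∧
    ∀ (pi1 : ℕ → (Fin n → ℝ) → Fin m1 → ℝ) (pi2 : ℕ → (Fin n → ℝ) → Fin m2 → ℝ),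
      (∀ s, 2 ≤ s → s ≤ K → Differentiable ℝ (pi1 s)) →
      (∀ s, 2 ≤ s → s ≤ K → Differentiable ℝ (pi2 s)) →
      (∀ s, 2 ≤ s → s ≤ K → pi1 s (x s) = u1 s) →
      (∀ s, 2 ≤ s → s ≤ K → pi2 s (x s) = u2 s) →
      ((∀ s, 2 ≤ s → s ≤ K → grad (fun w => l s (x s) (u1 s) w) (u2 s)
          + jacT (fun w => f s (x s) (u1 s) w) (u2 s) (lam1 s) - (0 : Fin m2 → ℝ) = 0) ∧
       (∀ s, 2 ≤ s → s ≤ K → grad (fun w => -(l s (x s) w (u2 s))) (u1 s)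
          + jacT (fun w => f s (x s) w (u2 s)) (u1 s) (lam2 s) - (0 : Fin m1 → ℝ) = 0) ∧
       (∀ t, 1 ≤ t → t ≤ K → grad (fun w => l t (x t) w (u2 t)) (u1 t)
          + jacT (fun w => f t (x t) w (u2 t)) (u1 t) (lam1 t) = 0) ∧
       (∀ t, 1 ≤ t → t ≤ K → grad (fun w => -(l t (x t) (u1 t) w)) (u2 t)
          + jacT (fun w => f t (x t) (u1 t) w) (u2 t) (lam2 t) = 0) ∧
       (grad lf (x (K+1)) - lam1 K = 0) ∧
       (grad (fun y => -(lf y)) (x (K+1)) - lam2 K = 0) ∧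
       (∀ s, 2 ≤ s → s ≤ K → grad (fun y => l s y (u1 s) (u2 s)) (x s) - lam1 (s-1)
          + jacT (fun y => f s y (u1 s) (u2 s)) (x s) (lam1 s)
          + jacT (pi2 s) (x s) (0 : Fin m2 → ℝ) = 0) ∧
       (∀ s, 2 ≤ s → s ≤ K → grad (fun y => -(l s y (u1 s) (u2 s))) (x s) - lam2 (s-1)
          + jacT (fun y => f s y (u1 s) (u2 s)) (x s) (lam2 s)
          + jacT (pi1 s) (x s) (0 : Fin m1 → ℝ) = 0)) := by
  have hanti : ∀ t, 1 ≤ t → t ≤ K → lam2 t = -lam1 t := by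
    intro t ht htK
    induction htK using Nat.decreasingInduction with
    | self =>
      rw [grad_neg] at hOL3b
      rw [← sub_eq_zero.mp hOL3b, sub_eq_zero.mp hOL3a]
    | of_succ k hk ih =>
      have ha := hOL1a (k + 1) (by omega) hk
      have hb := hOL1b (k + 1) (by omega) hk
      rw [grad_neg, ih (by omega), jacT_neg] at hb
      simp only [Nat.add_sub_cancel] at ha hb
      rw [← sub_eq_zero.mp ha, ← sub_eq_zero.mp hb, neg_add]
  refine ⟨hanti, fun pi1 pi2 _ _ _ _ => ⟨fun s hs hsK => ?_, fun s hs hsK => ?_, hOL2a, hOL2b,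
    hOL3a, hOL3b, fun s hs hsK => ?_, fun s hs hsK => ?_⟩⟩
  · have h := hOL2b s (by omega) hsK
    rw [grad_neg, hanti s (by omega) hsK, jacT_neg, ← neg_add, neg_eq_zero] at h
    rw [h, sub_zero]
  · rw [grad_neg, hanti s (by omega) hsK, jacT_neg, ← neg_add, hOL2a s (by omega) hsK,
      neg_zero, sub_zero]
  · rw [jacT_zero, add_zero, sub_add_eq_add_sub, hOL1a s hs hsK]
  · rw [jacT_zero, add_zero, sub_add_eq_add_sub, hOL1b s hs hsK]
end

section
/- Suppose both agents' feedback KKT systems hold (so in particular ψ^i_s = 0 for all s), and for agent i the feedback second-order necessary condition holds: Q^{i,FB}(d) ≥ 0 for every feedback critical direction d. Then the open-loop second-order necessary condition holds for agent i: Q^{i,OL}(d) ≥ 0 for every open-loop critical direction d. (Second-order part of Theorem 1, item 1.) -/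
open Matrix

noncomputable def hess2 {E : Type*} [NormedAddCommGroup E] [NormedSpace ℝ E]
    (G : E → ℝ) (a d : E) : ℝ :=
  iteratedFDeriv ℝ 2 G a ![d, d]

/-- Open-loop quadratic form for agent 1. -/
noncomputable def QOL1 {n m1 m2 : ℕ} (K : ℕ)
    (f : ℕ → (Fin n → ℝ) → (Fin m1 → ℝ) → (Fin m2 → ℝ) → Fin n → ℝ)
    (l : ℕ → (Fin n → ℝ) → (Fin m1 → ℝ) → (Fin m2 → ℝ) → ℝ)
    (lf : (Fin n → ℝ) → ℝ)
    (x : ℕ → Fin n → ℝ) (u1 : ℕ → Fin m1 → ℝ) (u2 : ℕ → Fin m2 → ℝ)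
    (lam1 : ℕ → Fin n → ℝ)
    (du1 : ℕ → Fin m1 → ℝ) (dx : ℕ → Fin n → ℝ) : ℝ :=
  hess2 (fun w => l 1 (x 1) w (u2 1)) (u1 1) (du1 1)
    + ∑ s ∈ Finset.Icc 2 K, hess2
        (fun p : (Fin n → ℝ) × (Fin m1 → ℝ) =>
          l s p.1 p.2 (u2 s) + lam1 s ⬝ᵥ f s p.1 p.2 (u2 s))
        (x s, u1 s) (dx s, du1 s)
    + hess2 lf (x (K+1)) (dx (K+1))

/-- Open-loop quadratic form for agent 2 (cost `-l`). -/
noncomputable def QOL2 {n m1 m2 : ℕ} (K : ℕ)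
    (f : ℕ → (Fin n → ℝ) → (Fin m1 → ℝ) → (Fin m2 → ℝ) → Fin n → ℝ)
    (l : ℕ → (Fin n → ℝ) → (Fin m1 → ℝ) → (Fin m2 → ℝ) → ℝ)
    (lf : (Fin n → ℝ) → ℝ)
    (x : ℕ → Fin n → ℝ) (u1 : ℕ → Fin m1 → ℝ) (u2 : ℕ → Fin m2 → ℝ)
    (lam2 : ℕ → Fin n → ℝ)
    (du2 : ℕ → Fin m2 → ℝ) (dx : ℕ → Fin n → ℝ) : ℝ :=
  hess2 (fun w => -(l 1 (x 1) (u1 1) w)) (u2 1) (du2 1)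
    + ∑ s ∈ Finset.Icc 2 K, hess2
        (fun p : (Fin n → ℝ) × (Fin m2 → ℝ) =>
          -(l s p.1 (u1 s) p.2) + lam2 s ⬝ᵥ f s p.1 (u1 s) p.2)
        (x s, u2 s) (dx s, du2 s)
    + hess2 (fun y => -(lf y)) (x (K+1)) (dx (K+1))

/-- Feedback quadratic form for agent 1. -/
noncomputable def QFB1 {n m1 m2 : ℕ} (K : ℕ)
    (f : ℕ → (Fin n → ℝ) → (Fin m1 → ℝ) → (Fin m2 → ℝ) → Fin n → ℝ)
    (l : ℕ → (Fin n → ℝ) → (Fin m1 → ℝ) → (Fin m2 → ℝ) → ℝ)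
    (lf : (Fin n → ℝ) → ℝ)
    (x : ℕ → Fin n → ℝ) (u1 : ℕ → Fin m1 → ℝ) (u2 : ℕ → Fin m2 → ℝ)
    (pi2 : ℕ → (Fin n → ℝ) → Fin m2 → ℝ)
    (lam1 : ℕ → Fin n → ℝ) (psi1 : ℕ → Fin m2 → ℝ)
    (du1 : ℕ → Fin m1 → ℝ) (du2 : ℕ → Fin m2 → ℝ) (dx : ℕ → Fin n → ℝ) : ℝ :=
  hess2 (fun w => l 1 (x 1) w (u2 1)) (u1 1) (du1 1)
    + ∑ s ∈ Finset.Icc 2 K, hess2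
        (fun p : (Fin n → ℝ) × (Fin m1 → ℝ) × (Fin m2 → ℝ) =>
          l s p.1 p.2.1 p.2.2 + lam1 s ⬝ᵥ f s p.1 p.2.1 p.2.2 + psi1 s ⬝ᵥ pi2 s p.1)
        (x s, u1 s, u2 s) (dx s, du1 s, du2 s)
    + hess2 lf (x (K+1)) (dx (K+1))

/-- Feedback quadratic form for agent 2 (cost `-l`). -/
noncomputable def QFB2 {n m1 m2 : ℕ} (K : ℕ)
    (f : ℕ → (Fin n → ℝ) → (Fin m1 → ℝ) → (Fin m2 → ℝ) → Fin n → ℝ)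
    (l : ℕ → (Fin n → ℝ) → (Fin m1 → ℝ) → (Fin m2 → ℝ) → ℝ)
    (lf : (Fin n → ℝ) → ℝ)
    (x : ℕ → Fin n → ℝ) (u1 : ℕ → Fin m1 → ℝ) (u2 : ℕ → Fin m2 → ℝ)
    (pi1 : ℕ → (Fin n → ℝ) → Fin m1 → ℝ)
    (lam2 : ℕ → Fin n → ℝ) (psi2 : ℕ → Fin m1 → ℝ)
    (du1 : ℕ → Fin m1 → ℝ) (du2 : ℕ → Fin m2 → ℝ) (dx : ℕ → Fin n → ℝ) : ℝ :=
  hess2 (fun w => -(l 1 (x 1) (u1 1) w)) (u2 1) (du2 1)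
    + ∑ s ∈ Finset.Icc 2 K, hess2
        (fun p : (Fin n → ℝ) × (Fin m1 → ℝ) × (Fin m2 → ℝ) =>
          -(l s p.1 p.2.1 p.2.2) + lam2 s ⬝ᵥ f s p.1 p.2.1 p.2.2 + psi2 s ⬝ᵥ pi1 s p.1)
        (x s, u1 s, u2 s) (dx s, du1 s, du2 s)
    + hess2 (fun y => -(lf y)) (x (K+1)) (dx (K+1))

/-- Open-loop critical direction for agent 1. -/
def OLdir1 {n m1 m2 : ℕ} (K : ℕ)
    (f : ℕ → (Fin n → ℝ) → (Fin m1 → ℝ) → (Fin m2 → ℝ) → Fin n → ℝ)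
    (x : ℕ → Fin n → ℝ) (u1 : ℕ → Fin m1 → ℝ) (u2 : ℕ → Fin m2 → ℝ)
    (du1 : ℕ → Fin m1 → ℝ) (dx : ℕ → Fin n → ℝ) : Prop :=
  dx 2 = fderiv ℝ (fun w => f 1 (x 1) w (u2 1)) (u1 1) (du1 1) ∧
  ∀ s, 2 ≤ s → s ≤ K → dx (s+1) =
    fderiv ℝ (fun y => f s y (u1 s) (u2 s)) (x s) (dx s)
      + fderiv ℝ (fun w => f s (x s) w (u2 s)) (u1 s) (du1 s)

/-- Open-loop critical direction for agent 2. -/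
def OLdir2 {n m1 m2 : ℕ} (K : ℕ)
    (f : ℕ → (Fin n → ℝ) → (Fin m1 → ℝ) → (Fin m2 → ℝ) → Fin n → ℝ)
    (x : ℕ → Fin n → ℝ) (u1 : ℕ → Fin m1 → ℝ) (u2 : ℕ → Fin m2 → ℝ)
    (du2 : ℕ → Fin m2 → ℝ) (dx : ℕ → Fin n → ℝ) : Prop :=
  dx 2 = fderiv ℝ (fun w => f 1 (x 1) (u1 1) w) (u2 1) (du2 1) ∧
  ∀ s, 2 ≤ s → s ≤ K → dx (s+1) =
    fderiv ℝ (fun y => f s y (u1 s) (u2 s)) (x s) (dx s)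
      + fderiv ℝ (fun w => f s (x s) (u1 s) w) (u2 s) (du2 s)

/-- Feedback critical direction for agent 1. -/
def FBdir1 {n m1 m2 : ℕ} (K : ℕ)
    (f : ℕ → (Fin n → ℝ) → (Fin m1 → ℝ) → (Fin m2 → ℝ) → Fin n → ℝ)
    (x : ℕ → Fin n → ℝ) (u1 : ℕ → Fin m1 → ℝ) (u2 : ℕ → Fin m2 → ℝ)
    (du1 : ℕ → Fin m1 → ℝ) (du2 : ℕ → Fin m2 → ℝ) (dx : ℕ → Fin n → ℝ) : Prop :=
  dx 2 = fderiv ℝ (fun w => f 1 (x 1) w (u2 1)) (u1 1) (du1 1) ∧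
  ∀ s, 2 ≤ s → s ≤ K → dx (s+1) =
    fderiv ℝ (fun y => f s y (u1 s) (u2 s)) (x s) (dx s)
      + fderiv ℝ (fun w => f s (x s) w (u2 s)) (u1 s) (du1 s)
      + fderiv ℝ (fun w => f s (x s) (u1 s) w) (u2 s) (du2 s)

/-- Feedback critical direction for agent 2. -/
def FBdir2 {n m1 m2 : ℕ} (K : ℕ)
    (f : ℕ → (Fin n → ℝ) → (Fin m1 → ℝ) → (Fin m2 → ℝ) → Fin n → ℝ)
    (x : ℕ → Fin n → ℝ) (u1 : ℕ → Fin m1 → ℝ) (u2 : ℕ → Fin m2 → ℝ)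
    (du1 : ℕ → Fin m1 → ℝ) (du2 : ℕ → Fin m2 → ℝ) (dx : ℕ → Fin n → ℝ) : Prop :=
  dx 2 = fderiv ℝ (fun w => f 1 (x 1) (u1 1) w) (u2 1) (du2 1) ∧
  ∀ s, 2 ≤ s → s ≤ K → dx (s+1) =
    fderiv ℝ (fun y => f s y (u1 s) (u2 s)) (x s) (dx s)
      + fderiv ℝ (fun w => f s (x s) w (u2 s)) (u1 s) (du1 s)
      + fderiv ℝ (fun w => f s (x s) (u1 s) w) (u2 s) (du2 s)

theorem hess2_comp_affine {E F : Type*} [NormedAddCommGroup E] [NormedSpace ℝ E]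
    [NormedAddCommGroup F] [NormedSpace ℝ F] {G : F → ℝ} (hG : ContDiff ℝ 2 G)
    (L : E →L[ℝ] F) (c : F) (a d : E) :
    hess2 (fun p => G (L p + c)) a d = hess2 G (L a + c) (L d) := by
  have hGc : ContDiff ℝ 2 (fun y => G (y + c)) := hG.comp (contDiff_id.add contDiff_const)
  have h := L.iteratedFDeriv_comp_right hGc a (i := 2) le_rfl
  have hcomp : (fun p => G (L p + c)) = (fun y => G (y + c)) ∘ L := rfl
  rw [hess2, hcomp, h, iteratedFDeriv_comp_add_right, hess2,
    ContinuousMultilinearMap.compContinuousLinearMap_apply]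
  congr 1
  ext i
  fin_cases i <;> rfl

theorem hess2_partial_fst {E F H : Type*} [NormedAddCommGroup E] [NormedSpace ℝ E]
    [NormedAddCommGroup F] [NormedSpace ℝ F] [NormedAddCommGroup H] [NormedSpace ℝ H]
    {G : E × F × H → ℝ} (hG : ContDiff ℝ 2 G) (a d : E) (b e : F) (c : H) :
    hess2 (fun p : E × F => G (p.1, p.2, c)) (a, b) (d, e) = hess2 G (a, b, c) (d, e, 0) := by
  simpa using hess2_comp_affine hG ((ContinuousLinearMap.fst ℝ E F).prod
    ((ContinuousLinearMap.snd ℝ E F).prod 0)) ((0, 0, c) : E × F × H) (a, b) (d, e)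

theorem hess2_partial_snd {E F H : Type*} [NormedAddCommGroup E] [NormedSpace ℝ E]
    [NormedAddCommGroup F] [NormedSpace ℝ F] [NormedAddCommGroup H] [NormedSpace ℝ H]
    {G : E × F × H → ℝ} (hG : ContDiff ℝ 2 G) (a d : E) (b : F) (c e : H) :
    hess2 (fun p : E × H => G (p.1, b, p.2)) (a, c) (d, e) = hess2 G (a, b, c) (d, 0, e) := by
  simpa using hess2_comp_affine hG ((ContinuousLinearMap.fst ℝ E H).prod
    ((0 : E × H →L[ℝ] F).prod (ContinuousLinearMap.snd ℝ E H))) ((0, b, 0) : E × F × H)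
    (a, c) (d, e)

theorem ContDiff.const_dotProduct {E : Type*} [NormedAddCommGroup E] [NormedSpace ℝ E]
    {q : ℕ} {k : WithTop ℕ∞} {F : E → Fin q → ℝ} (hF : ContDiff ℝ k F) (v : Fin q → ℝ) :
    ContDiff ℝ k (fun p => v ⬝ᵥ F p) :=
  ContDiff.sum fun j _ => contDiff_const.mul (contDiff_pi.1 hF j)

/-- Under both agents' feedback KKT systems, the feedback second-order
necessary condition for agent `i` implies the open-loop second-order necessary condition
for agent `i` (second-order part of Theorem 1, item 1). -/
theorem fb_second_order_necessary_implies_ol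
    {n m1 m2 K : ℕ} (hK : 1 ≤ K)
    (f : ℕ → (Fin n → ℝ) → (Fin m1 → ℝ) → (Fin m2 → ℝ) → Fin n → ℝ)
    (l : ℕ → (Fin n → ℝ) → (Fin m1 → ℝ) → (Fin m2 → ℝ) → ℝ)
    (lf : (Fin n → ℝ) → ℝ)
    (x : ℕ → Fin n → ℝ) (u1 : ℕ → Fin m1 → ℝ) (u2 : ℕ → Fin m2 → ℝ)
    (pi1 : ℕ → (Fin n → ℝ) → Fin m1 → ℝ) (pi2 : ℕ → (Fin n → ℝ) → Fin m2 → ℝ)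
    (lam1 lam2 : ℕ → Fin n → ℝ)
    (psi1 : ℕ → Fin m2 → ℝ) (psi2 : ℕ → Fin m1 → ℝ)
    (hf2 : ∀ t, 1 ≤ t → t ≤ K → ContDiff ℝ 2
      (fun p : (Fin n → ℝ) × (Fin m1 → ℝ) × (Fin m2 → ℝ) => f t p.1 p.2.1 p.2.2))
    (hl2 : ∀ t, 1 ≤ t → t ≤ K → ContDiff ℝ 2
      (fun p : (Fin n → ℝ) × (Fin m1 → ℝ) × (Fin m2 → ℝ) => l t p.1 p.2.1 p.2.2))
    (hlf2 : ContDiff ℝ 2 lf)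
    (hpi1d : ∀ s, 2 ≤ s → s ≤ K → ContDiff ℝ 2 (pi1 s))
    (hpi2d : ∀ s, 2 ≤ s → s ≤ K → ContDiff ℝ 2 (pi2 s))
    (hdyn : ∀ t, 1 ≤ t → t ≤ K → x (t+1) = f t (x t) (u1 t) (u2 t))
    (hpc1 : ∀ s, 2 ≤ s → s ≤ K → pi1 s (x s) = u1 s)
    (hpc2 : ∀ s, 2 ≤ s → s ≤ K → pi2 s (x s) = u2 s)
    (hFB1a : ∀ s, 2 ≤ s → s ≤ K → grad (fun w => l s (x s) (u1 s) w) (u2 s)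
      + jacT (fun w => f s (x s) (u1 s) w) (u2 s) (lam1 s) - psi1 s = 0)
    (hFB1b : ∀ s, 2 ≤ s → s ≤ K → grad (fun w => -(l s (x s) w (u2 s))) (u1 s)
      + jacT (fun w => f s (x s) w (u2 s)) (u1 s) (lam2 s) - psi2 s = 0)
    (hFB2a : ∀ t, 1 ≤ t → t ≤ K → grad (fun w => l t (x t) w (u2 t)) (u1 t)
      + jacT (fun w => f t (x t) w (u2 t)) (u1 t) (lam1 t) = 0)
    (hFB2b : ∀ t, 1 ≤ t → t ≤ K → grad (fun w => -(l t (x t) (u1 t) w)) (u2 t)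
      + jacT (fun w => f t (x t) (u1 t) w) (u2 t) (lam2 t) = 0)
    (hFB3a : grad lf (x (K+1)) - lam1 K = 0)
    (hFB3b : grad (fun y => -(lf y)) (x (K+1)) - lam2 K = 0)
    (hFB4a : ∀ s, 2 ≤ s → s ≤ K → grad (fun y => l s y (u1 s) (u2 s)) (x s) - lam1 (s-1)
      + jacT (fun y => f s y (u1 s) (u2 s)) (x s) (lam1 s) + jacT (pi2 s) (x s) (psi1 s) = 0)
    (hFB4b : ∀ s, 2 ≤ s → s ≤ K → grad (fun y => -(l s y (u1 s) (u2 s))) (x s) - lam2 (s-1)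
      + jacT (fun y => f s y (u1 s) (u2 s)) (x s) (lam2 s) + jacT (pi1 s) (x s) (psi2 s) = 0)
 :
    ((∀ (du1 : ℕ → Fin m1 → ℝ) (du2 : ℕ → Fin m2 → ℝ) (dx : ℕ → Fin n → ℝ),
        FBdir1 K f x u1 u2 du1 du2 dx →
        0 ≤ QFB1 K f l lf x u1 u2 pi2 lam1 psi1 du1 du2 dx) →
      ∀ (du1 : ℕ → Fin m1 → ℝ) (dx : ℕ → Fin n → ℝ),
        OLdir1 K f x u1 u2 du1 dx → 0 ≤ QOL1 K f l lf x u1 u2 lam1 du1 dx) ∧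
    ((∀ (du1 : ℕ → Fin m1 → ℝ) (du2 : ℕ → Fin m2 → ℝ) (dx : ℕ → Fin n → ℝ),
        FBdir2 K f x u1 u2 du1 du2 dx →
        0 ≤ QFB2 K f l lf x u1 u2 pi1 lam2 psi2 du1 du2 dx) →
      ∀ (du2 : ℕ → Fin m2 → ℝ) (dx : ℕ → Fin n → ℝ),
        OLdir2 K f x u1 u2 du2 dx → 0 ≤ QOL2 K f l lf x u1 u2 lam2 du2 dx) := by
  have psi_eq_zero : ∀ s, 2 ≤ s → s ≤ K → lam2 s = -lam1 s → psi1 s = 0 ∧ psi2 s = 0 := by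
    intro s hs hsK hlam
    have h1 := hFB1a s hs hsK
    have h2 := hFB1b s hs hsK
    have h3 := hFB2a s (by omega) hsK
    have h4 := hFB2b s (by omega) hsK
    rw [grad_neg, hlam, jacT_neg] at h2 h4
    constructor
    · linear_combination -h1 - h4
    · linear_combination -h2 - h3
  have lam_antisymm : ∀ s, 1 ≤ s → s ≤ K → lam2 s = -lam1 s := by
    intro s hs hsK
    induction hsK using Nat.decreasingInduction with
    | self =>
      rw [grad_neg] at hFB3b
      linear_combination -hFB3b - hFB3a
    | of_succ s hlt ih =>
      have hlam := ih (by omega)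
      obtain ⟨hpsi1, hpsi2⟩ := psi_eq_zero (s + 1) (by omega) hlt hlam
      have h1 := hFB4a (s + 1) (by omega) hlt
      have h2 := hFB4b (s + 1) (by omega) hlt
      rw [hpsi1, jacT_zero, Nat.add_sub_cancel] at h1
      rw [grad_neg, hlam, jacT_neg, hpsi2, jacT_zero, Nat.add_sub_cancel] at h2
      linear_combination -h1 - h2
  have hpsi : ∀ s, 2 ≤ s → s ≤ K → psi1 s = 0 ∧ psi2 s = 0 := fun s hs hsK =>
    psi_eq_zero s hs hsK (lam_antisymm s (by omega) hsK)
  constructor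
  · intro hFB du1 dx hd
    have h := hFB du1 0 dx ⟨hd.1, fun s hs hsK => by simpa using hd.2 s hs hsK⟩
    convert h using 1
    unfold QOL1 QFB1
    congr 2
    refine Finset.sum_congr rfl fun s hs => ?_
    obtain ⟨hs2, hsK⟩ := Finset.mem_Icc.1 hs
    simp only [(hpsi s hs2 hsK).1, zero_dotProduct, add_zero]
    exact hess2_partial_fst ((hl2 s (by omega) hsK).add
      ((hf2 s (by omega) hsK).const_dotProduct (lam1 s))) _ _ _ _ _
  · intro hFB du2 dx hd
    have h := hFB 0 du2 dx ⟨hd.1, fun s hs hsK => by simpa using hd.2 s hs hsK⟩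
    convert h using 1
    unfold QOL2 QFB2
    congr 2
    refine Finset.sum_congr rfl fun s hs => ?_
    obtain ⟨hs2, hsK⟩ := Finset.mem_Icc.1 hs
    simp only [(hpsi s hs2 hsK).2, zero_dotProduct, add_zero]
    exact hess2_partial_snd ((hl2 s (by omega) hsK).neg.add
      ((hf2 s (by omega) hsK).const_dotProduct (lam2 s))) _ _ _ _ _
end

section
/- If (u^{1*}, u^{2*}) is a local open-loop Nash equilibrium, i.e. u^{1*} is a local minimizer of u¹ ↦ J(u¹, u^{2*}) and u^{2*} is a local maximizer of u² ↦ J(u^{1*}, u²), and x_t = x_t(u^{1*}, u^{2*}) is the corresponding rollout, then the multipliers defined by the backward recursion λ^i_K = ∇g^i_{K+1}(x_{K+1}) and λ^i_{t−1} = ∇_x g^i_t + (D_x f_t)^⊤ λ^i_t (t = K,…,2) satisfy λ²_t = −λ¹_t for all t, and both agents' open-loop KKT systems hold: (OL1) ∇_x g^i_t + (D_x f_t)^⊤ λ^i_t − λ^i_{t−1} = 0 for t = 2,…,K; (OL2) ∇_{u^i} g^i_t + (D_{u^i} f_t)^⊤ λ^i_t = 0 for t = 1,…,K; (OL3) ∇g^i_{K+1}(x_{K+1})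 − λ^i_K = 0. -/
open Matrix

/-- State rollout: `rollout f x1 U1 U2 t` is the state at time `t ∈ {1, …, K+1}`
(1-indexed; controls `U1 i`, `U2 i` act at time `i+1`). -/
noncomputable def rollout {n m1 m2 K : ℕ}
    (f : ℕ → (Fin n → ℝ) → (Fin m1 → ℝ) → (Fin m2 → ℝ) → Fin n → ℝ)
    (x1 : Fin n → ℝ) (U1 : Fin K → Fin m1 → ℝ) (U2 : Fin K → Fin m2 → ℝ) :
    ℕ → Fin n → ℝ
  | 0 => x1
  | t+1 => if h : 1 ≤ t ∧ t ≤ K then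
      f t (rollout f x1 U1 U2 t) (U1 ⟨t-1, by omega⟩) (U2 ⟨t-1, by omega⟩)
    else x1

/-- Total (cumulative) cost of agent 1 as a function of the control sequences. -/
noncomputable def Jcost {n m1 m2 K : ℕ}
    (f : ℕ → (Fin n → ℝ) → (Fin m1 → ℝ) → (Fin m2 → ℝ) → Fin n → ℝ)
    (l : ℕ → (Fin n → ℝ) → (Fin m1 → ℝ) → (Fin m2 → ℝ) → ℝ)
    (lf : (Fin n → ℝ) → ℝ) (x1 : Fin n → ℝ)
    (U1 : Fin K → Fin m1 → ℝ) (U2 : Fin K → Fin m2 → ℝ) : ℝ :=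
  (∑ t : Fin K, l ((t : ℕ)+1) (rollout f x1 U1 U2 ((t : ℕ)+1)) (U1 t) (U2 t))
    + lf (rollout f x1 U1 U2 (K+1))

theorem fderiv_eq_grad_dotProduct {p : ℕ} (G : (Fin p → ℝ) → ℝ) (a v : Fin p → ℝ) :
    fderiv ℝ G a v = grad G a ⬝ᵥ v := by
  conv_lhs => rw [pi_eq_sum_univ' v]
  simp [grad, dotProduct, map_sum, mul_comm]

theorem grad_add_comp {p q : ℕ} {G : (Fin p → ℝ) → ℝ} {F : (Fin p → ℝ) → Fin q → ℝ}
    {V : (Fin q → ℝ) → ℝ} {a : Fin p → ℝ} (hG : DifferentiableAt ℝ G a)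
    (hF : DifferentiableAt ℝ F a) (hV : DifferentiableAt ℝ V (F a)) :
    grad (fun y => G y + V (F y)) a = grad G a + jacT F a (grad V (F a)) := by
  have h := (hG.hasFDerivAt.add (hV.hasFDerivAt.comp a hF.hasFDerivAt)).fderiv
  ext j
  change fderiv ℝ (G + V ∘ F) a (Pi.single j 1) = _
  rw [h]
  simp [fderiv_eq_grad_dotProduct V, jacT, grad]

/-- Cost accumulated over `k` steps from state `y` at time `t` under the controls `u`, including
the terminal cost. -/
def costToGo {X W : Type*} (F : ℕ → X → W → X) (L : ℕ → X → W → ℝ) (lf : X → ℝ) (u : ℕ → W) :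
    ℕ → ℕ → X → ℝ
  | 0, _, y => lf y
  | k + 1, t, y => L t y (u t) + costToGo F L lf u k (t + 1) (F t y (u t))

section CostToGo

variable {X W : Type*} {F : ℕ → X → W → X} {L : ℕ → X → W → ℝ} {lf : X → ℝ}

theorem costToGo_update_of_lt (u : ℕ → W) (w : W) {s : ℕ} (k t : ℕ) (y : X) (h : s < t) :
    costToGo F L lf (Function.update u s w) k t y = costToGo F L lf u k t y := by
  induction k generalizing t y with
  | zero => rfl
  | succ k ih =>
    simp only [costToGo, Function.update_of_ne h.ne']
    rw [ih _ _ (by omega)]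

theorem exists_costToGo_update_eq (u : ℕ → W) (x : ℕ → X) (t k j s : ℕ) (hs : s + j = t)
    (hx : ∀ r, s ≤ r → r < t → x (r + 1) = F r (x r) (u r)) :
    ∃ c : ℝ, ∀ w, costToGo F L lf (Function.update u t w) (k + 1 + j) s (x s)
      = c + (L t (x t) w + costToGo F L lf u k (t + 1) (F t (x t) w)) := by
  induction j generalizing s with
  | zero =>
    obtain rfl : s = t := hs
    exact ⟨0, fun w => by simp [costToGo, costToGo_update_of_lt]⟩
  | succ j ih =>
    obtain ⟨c, hc⟩ := ih (s + 1) (by omega) fun r hr => hx r (by omega)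
    refine ⟨L s (x s) (u s) + c, fun w => ?_⟩
    rw [← add_assoc, costToGo, Function.update_of_ne (by omega), ← hx s le_rfl (by omega), hc]
    ring

end CostToGo

theorem grad_costToGo {n m K : ℕ} {F : ℕ → (Fin n → ℝ) → (Fin m → ℝ) → Fin n → ℝ}
    {L : ℕ → (Fin n → ℝ) → (Fin m → ℝ) → ℝ} {lf : (Fin n → ℝ) → ℝ}
    {x : ℕ → Fin n → ℝ} {u : ℕ → Fin m → ℝ} {lam : ℕ → Fin n → ℝ}
    (hx : ∀ t, 1 ≤ t → t ≤ K → x (t + 1) = F t (x t) (u t))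
    (hF : ∀ t, 1 ≤ t → t ≤ K → Differentiable ℝ fun y => F t y (u t))
    (hL : ∀ t, 1 ≤ t → t ≤ K → Differentiable ℝ fun y => L t y (u t))
    (hlf : Differentiable ℝ lf) (hlamK : lam K = grad lf (x (K + 1)))
    (hlam : ∀ t, 2 ≤ t → t ≤ K → lam (t - 1) = grad (fun y => L t y (u t)) (x t)
      + jacT (fun y => F t y (u t)) (x t) (lam t))
    (k t : ℕ) (ht : 1 ≤ t) (htk : t + k = K) :
    Differentiable ℝ (costToGo F L lf u k (t + 1)) ∧
      grad (costToGo F L lf u k (t + 1)) (x (t + 1)) = lam t := by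
  induction k generalizing t with
  | zero =>
    obtain rfl : t = K := htk
    exact ⟨hlf, hlamK.symm⟩
  | succ k ih =>
    obtain ⟨hd, hg⟩ := ih (t + 1) (by omega) (by omega)
    have hF' := hF (t + 1) (by omega) (by omega)
    have hL' := hL (t + 1) (by omega) (by omega)
    refine ⟨hL'.add (hd.comp hF'), ?_⟩
    have hrec := hlam (t + 1) (by omega) (by omega)
    rw [Nat.add_sub_cancel] at hrec
    rw [hrec, ← hg, hx (t + 1) (by omega) (by omega)]
    exact grad_add_comp (hL' _) (hF' _) (hd _)

/-- The stationarity condition of the minimum principle for a single controller. -/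
theorem grad_add_jacT_eq_zero_of_isLocalExtr {n m K : ℕ}
    {F : ℕ → (Fin n → ℝ) → (Fin m → ℝ) → Fin n → ℝ}
    {L : ℕ → (Fin n → ℝ) → (Fin m → ℝ) → ℝ} {lf : (Fin n → ℝ) → ℝ}
    {x : ℕ → Fin n → ℝ} {u : ℕ → Fin m → ℝ} {lam : ℕ → Fin n → ℝ}
    (hx : ∀ t, 1 ≤ t → t ≤ K → x (t + 1) = F t (x t) (u t))
    (hF : ∀ t, 1 ≤ t → t ≤ K → Differentiable ℝ fun p : (Fin n → ℝ) × (Fin m → ℝ) => F t p.1 p.2)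
    (hL : ∀ t, 1 ≤ t → t ≤ K → Differentiable ℝ fun p : (Fin n → ℝ) × (Fin m → ℝ) => L t p.1 p.2)
    (hlf : Differentiable ℝ lf) (hlamK : lam K = grad lf (x (K + 1)))
    (hlam : ∀ t, 2 ≤ t → t ≤ K → lam (t - 1) = grad (fun y => L t y (u t)) (x t)
      + jacT (fun y => F t y (u t)) (x t) (lam t))
    {t : ℕ} (ht : 1 ≤ t) (htK : t ≤ K)
    (hext : IsLocalExtr (fun w => costToGo F L lf (Function.update u t w) K 1 (x 1)) (u t)) :
    grad (fun w => L t (x t) w) (u t) + jacT (fun w => F t (x t) w) (u t) (lam t) = 0 := by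
  obtain ⟨hd, hg⟩ := grad_costToGo hx
    (fun s h1 h2 => (hF s h1 h2).comp (differentiable_id.prodMk (differentiable_const _)))
    (fun s h1 h2 => (hL s h1 h2).comp (differentiable_id.prodMk (differentiable_const _)))
    hlf hlamK hlam (K - t) t ht (by omega)
  have hFw : Differentiable ℝ fun w => F t (x t) w :=
    (hF t ht htK).comp ((differentiable_const _).prodMk differentiable_id)
  have hLw : Differentiable ℝ fun w => L t (x t) w :=
    (hL t ht htK).comp ((differentiable_const _).prodMk differentiable_id)
  obtain ⟨c, hc⟩ := exists_costToGo_update_eq (F := F) (L := L) (lf := lf) u x t (K - t) (t - 1) 1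
    (by omega) fun r h1 h2 => hx r h1 (by omega)
  rw [show K - t + 1 + (t - 1) = K by omega] at hc
  simp only [hc] at hext
  have hzero := hext.fderiv_eq_zero
  rw [fderiv_const_add] at hzero
  rw [← hg, hx t ht htK]
  refine (grad_add_comp (hLw _) (hFw _) (hd _)).symm.trans ?_
  ext j
  simp [grad, hzero]

theorem Jcost_eq_costToGo {n m1 m2 K : ℕ} {W : Type*}
    (f : ℕ → (Fin n → ℝ) → (Fin m1 → ℝ) → (Fin m2 → ℝ) → Fin n → ℝ)
    (l : ℕ → (Fin n → ℝ) → (Fin m1 → ℝ) → (Fin m2 → ℝ) → ℝ)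
    (lf : (Fin n → ℝ) → ℝ) (x1 : Fin n → ℝ)
    (U1 : Fin K → Fin m1 → ℝ) (U2 : Fin K → Fin m2 → ℝ)
    (F : ℕ → (Fin n → ℝ) → W → Fin n → ℝ) (L : ℕ → (Fin n → ℝ) → W → ℝ) (u : ℕ → W)
    (hF : ∀ (i : Fin K) y, F (i + 1) y (u (i + 1)) = f (i + 1) y (U1 i) (U2 i))
    (hL : ∀ (i : Fin K) y, L (i + 1) y (u (i + 1)) = l (i + 1) y (U1 i) (U2 i)) :
    Jcost f l lf x1 U1 U2 = costToGo F L lf u K 1 x1 := by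
  set r := rollout f x1 U1 U2 with hr
  have hstep : ∀ i < K, r (i + 2) = F (i + 1) (r (i + 1)) (u (i + 1)) := by
    intro i hi
    rw [hF ⟨i, hi⟩, hr, rollout, dif_pos ⟨by omega, by omega⟩]
    simp
  have key : ∀ k j, j + k = K → costToGo F L lf u k (j + 1) (r (j + 1))
      = (∑ i ∈ Finset.Ico j K, L (i + 1) (r (i + 1)) (u (i + 1))) + lf (r (K + 1)) := by
    intro k
    induction k with
    | zero => rintro j rfl; simp [costToGo]
    | succ k ih =>
      intro j hj
      rw [costToGo, ← hstep j (by omega), ih (j + 1) (by omega),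
        Finset.sum_eq_sum_Ico_succ_bot (by omega : j < K), add_assoc]
  have h0 : r 1 = x1 := by simp [hr, rollout]
  have h := key K 0 (by omega)
  rw [zero_add, h0] at h
  rw [h, ← Finset.range_eq_Ico, ← Fin.sum_univ_eq_sum_range
    (fun i => L (i + 1) (r (i + 1)) (u (i + 1)))]
  simp only [hL]
  rfl

theorem update_succ_apply_succ {α : Type*} {K : ℕ} {u : ℕ → α} {U : Fin K → α}
    (h : ∀ i : Fin K, u (i + 1) = U i) (j : Fin K) (w : α) (i : Fin K) :
    Function.update u (j + 1) w (i + 1) = Function.update U j w i := by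
  by_cases hij : i = j
  · subst hij; simp
  · have : (i : ℕ) + 1 ≠ j + 1 := by simpa [Fin.ext_iff] using hij
    rw [Function.update_of_ne this, Function.update_of_ne hij, h]

/-- At a local open-loop Nash equilibrium, the multipliers defined by the
backward adjoint recursion are antisymmetric and both agents' open-loop KKT systems hold. -/
theorem olne_first_order_conditions
    {n m1 m2 K : ℕ} (hK : 1 ≤ K)
    (f : ℕ → (Fin n → ℝ) → (Fin m1 → ℝ) → (Fin m2 → ℝ) → Fin n → ℝ)
    (l : ℕ → (Fin n → ℝ) → (Fin m1 → ℝ) → (Fin m2 → ℝ) → ℝ)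
    (lf : (Fin n → ℝ) → ℝ)
    (x1 : Fin n → ℝ) (U1s : Fin K → Fin m1 → ℝ) (U2s : Fin K → Fin m2 → ℝ)
    (x : ℕ → Fin n → ℝ) (u1 : ℕ → Fin m1 → ℝ) (u2 : ℕ → Fin m2 → ℝ)
    (hx : ∀ t, x t = rollout f x1 U1s U2s t)
    (hu1 : ∀ t : Fin K, u1 ((t : ℕ)+1) = U1s t)
    (hu2 : ∀ t : Fin K, u2 ((t : ℕ)+1) = U2s t)
    (hfd : ∀ t, 1 ≤ t → t ≤ K → Differentiable ℝ
      (fun p : (Fin n → ℝ) × (Fin m1 → ℝ) × (Fin m2 → ℝ) => f t p.1 p.2.1 p.2.2))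
    (hld : ∀ t, 1 ≤ t → t ≤ K → Differentiable ℝ
      (fun p : (Fin n → ℝ) × (Fin m1 → ℝ) × (Fin m2 → ℝ) => l t p.1 p.2.1 p.2.2))
    (hlfd : Differentiable ℝ lf)
    (hmin : IsLocalMin (fun U : Fin K → Fin m1 → ℝ => Jcost f l lf x1 U U2s) U1s)
    (hmax : IsLocalMax (fun U : Fin K → Fin m2 → ℝ => Jcost f l lf x1 U1s U) U2s)
    (lam1 lam2 : ℕ → Fin n → ℝ)
    (hl1K : lam1 K = grad lf (x (K+1)))
    (hl1rec : ∀ t, 2 ≤ t → t ≤ K → lam1 (t-1) = grad (fun y => l t y (u1 t) (u2 t)) (x t)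
      + jacT (fun y => f t y (u1 t) (u2 t)) (x t) (lam1 t))
    (hl2K : lam2 K = grad (fun y => -(lf y)) (x (K+1)))
    (hl2rec : ∀ t, 2 ≤ t → t ≤ K → lam2 (t-1) = grad (fun y => -(l t y (u1 t) (u2 t))) (x t)
      + jacT (fun y => f t y (u1 t) (u2 t)) (x t) (lam2 t)) :
    (∀ t, 1 ≤ t → t ≤ K → lam2 t = -lam1 t) ∧
    (∀ t, 2 ≤ t → t ≤ K → grad (fun y => l t y (u1 t) (u2 t)) (x t)
      + jacT (fun y => f t y (u1 t) (u2 t)) (x t) (lam1 t) - lam1 (t-1) = 0) ∧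
    (∀ t, 1 ≤ t → t ≤ K → grad (fun w => l t (x t) w (u2 t)) (u1 t)
      + jacT (fun w => f t (x t) w (u2 t)) (u1 t) (lam1 t) = 0) ∧
    (grad lf (x (K+1)) - lam1 K = 0) ∧
    (∀ t, 2 ≤ t → t ≤ K → grad (fun y => -(l t y (u1 t) (u2 t))) (x t)
      + jacT (fun y => f t y (u1 t) (u2 t)) (x t) (lam2 t) - lam2 (t-1) = 0) ∧
    (∀ t, 1 ≤ t → t ≤ K → grad (fun w => -(l t (x t) (u1 t) w)) (u2 t)
      + jacT (fun w => f t (x t) (u1 t) w) (u2 t) (lam2 t) = 0) ∧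
    (grad (fun y => -(lf y)) (x (K+1)) - lam2 K = 0) := by
  have hx1 : x 1 = x1 := by simp [hx, rollout]
  have hstep : ∀ t, 1 ≤ t → t ≤ K → x (t + 1) = f t (x t) (u1 t) (u2 t) := by
    intro t h1 h2
    obtain ⟨i, rfl⟩ : ∃ i, t = i + 1 := ⟨t - 1, by omega⟩
    have e1 := hu1 ⟨i, by omega⟩
    have e2 := hu2 ⟨i, by omega⟩
    simp only at e1 e2
    rw [hx, hx, e1, e2, rollout, dif_pos ⟨h1, h2⟩]
    simp
  have hneg : ∀ t, 1 ≤ t → t ≤ K → lam2 t = -lam1 t := by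
    intro t h1 h2
    induction h2 using Nat.decreasingInduction with
    | self => rw [hl2K, hl1K, grad_neg]
    | of_succ t ht ih =>
      have e1 := hl1rec (t + 1) (by omega) (by omega)
      have e2 := hl2rec (t + 1) (by omega) (by omega)
      rw [Nat.add_sub_cancel] at e1 e2
      rw [e2, e1, ih (by omega), grad_neg, jacT_neg, neg_add]
  have hst1 : ∀ t, 1 ≤ t → t ≤ K → grad (fun w => l t (x t) w (u2 t)) (u1 t)
      + jacT (fun w => f t (x t) w (u2 t)) (u1 t) (lam1 t) = 0 := by
    intro t h1 h2
    obtain ⟨i, rfl⟩ : ∃ i : Fin K, t = i + 1 := ⟨⟨t - 1, by omega⟩, by simp; omega⟩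
    refine grad_add_jacT_eq_zero_of_isLocalExtr
      (F := fun t y w => f t y w (u2 t)) (L := fun t y w => l t y w (u2 t)) hstep
      (fun s a b => (hfd s a b).comp
        (differentiable_fst.prodMk (differentiable_snd.prodMk (differentiable_const _))))
      (fun s a b => (hld s a b).comp
        (differentiable_fst.prodMk (differentiable_snd.prodMk (differentiable_const _))))
      hlfd hl1K hl1rec h1 h2 (Or.inl ?_)
    have hcomp : IsLocalMin (fun w => Jcost f l lf x1 (Function.update U1s i w) U2s)
        (u1 (i + 1)) := by
      refine IsLocalMin.comp_continuous (f := fun U => Jcost f l lf x1 U U2s)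
        (g := fun w => Function.update U1s i w) ?_
        (continuous_const.update i continuous_id).continuousAt
      rw [hu1, Function.update_eq_self]
      exact hmin
    refine hcomp.congr (Filter.Eventually.of_forall fun w => ?_)
    rw [hx1]
    refine (Jcost_eq_costToGo f l lf x1 _ _ _ _ _ ?_ ?_) <;>
      intro j y <;> simp only [update_succ_apply_succ hu1, hu2]
  have hst2 : ∀ t, 1 ≤ t → t ≤ K → grad (fun w => l t (x t) (u1 t) w) (u2 t)
      + jacT (fun w => f t (x t) (u1 t) w) (u2 t) (lam1 t) = 0 := by
    intro t h1 h2
    obtain ⟨i, rfl⟩ : ∃ i : Fin K, t = i + 1 := ⟨⟨t - 1, by omega⟩, by simp; omega⟩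
    refine grad_add_jacT_eq_zero_of_isLocalExtr
      (F := fun t y w => f t y (u1 t) w) (L := fun t y w => l t y (u1 t) w) hstep
      (fun s a b => (hfd s a b).comp
        (differentiable_fst.prodMk ((differentiable_const _).prodMk differentiable_snd)))
      (fun s a b => (hld s a b).comp
        (differentiable_fst.prodMk ((differentiable_const _).prodMk differentiable_snd)))
      hlfd hl1K hl1rec h1 h2 (Or.inr ?_)
    have hcomp : IsLocalMax (fun w => Jcost f l lf x1 U1s (Function.update U2s i w))
        (u2 (i + 1)) := by
      refine IsLocalMax.comp_continuous (f := fun U => Jcost f l lf x1 U1s U)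
        (g := fun w => Function.update U2s i w) ?_
        (continuous_const.update i continuous_id).continuousAt
      rw [hu2, Function.update_eq_self]
      exact hmax
    refine hcomp.congr (Filter.Eventually.of_forall fun w => ?_)
    rw [hx1]
    refine (Jcost_eq_costToGo f l lf x1 _ _ _ _ _ ?_ ?_) <;>
      intro j y <;> simp only [update_succ_apply_succ hu2, hu1]
  refine ⟨hneg, fun t h1 h2 => ?_, hst1, ?_, fun t h1 h2 => ?_, fun t h1 h2 => ?_, ?_⟩
  · rw [hl1rec t h1 h2, sub_self]
  · rw [hl1K, sub_self]
  · rw [hl2rec t h1 h2, sub_self]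
  · rw [hneg t h1 h2, grad_neg, jacT_neg, ← neg_add, hst2 t h1 h2, neg_zero]
  · rw [hl2K, sub_self]
end

section
/- Consider the game with control bounds. Suppose both agents' constrained open-loop KKT systems hold with multipliers λ^i, ν̲^i, ν̄^i, and differentiable policies π^j_s : ℝⁿ → ℝ^{m_j} with π^j_s(x_s) = u^j_s (s = 2,…,K) are given for which the strict-complementarity policy dichotomy holds. Then λ²_t = −λ¹_t for all t, and both agents' constrained feedback KKT systems hold with the same λ^i, ν̲^i, ν̄^i and with feedback-policy multipliers ψ¹_s = ν̄²_s − ν̲²_s and ψ²_s = ν̄¹_s − ν̲¹_s for s = 2,…,K. (Theorem 2, part 2: any local OLNE of the control-bounded game at which strict complementarity holds satisfies the first-order necessary conditions for a local FBNE.) -/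
open Matrix

/-- The pullback of `lam` vanishes if each component of `F` with nonzero multiplier has zero
derivative. -/
theorem jacT_eq_zero {p q : ℕ} {F : (Fin p → ℝ) → Fin q → ℝ} {a : Fin p → ℝ} {lam : Fin q → ℝ}
    (h : ∀ i, (∀ v, fderiv ℝ F a v i = 0) ∨ lam i = 0) : jacT F a lam = 0 := by
  funext j
  simp only [jacT, dotProduct, Pi.zero_apply]
  refine Finset.sum_eq_zero fun i _ => ?_
  rcases h i with h | h <;> simp [h]

/-- (Theorem 2, part 2.) Control-bounded game: a trajectory satisfying
both agents' constrained open-loop KKT systems, at which the strict-complementarity policy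
dichotomy holds for given consistent differentiable policies, has antisymmetric adjoint
multipliers and satisfies both agents' constrained feedback KKT systems with the same
`λⁱ, ν̲ⁱ, ν̄ⁱ` and with `ψ¹_s = ν̄²_s - ν̲²_s`, `ψ²_s = ν̄¹_s - ν̲¹_s`. -/
theorem constrained_olne_implies_fbne_first_order
    {n m1 m2 K : ℕ} (hK : 1 ≤ K)
    (f : ℕ → (Fin n → ℝ) → (Fin m1 → ℝ) → (Fin m2 → ℝ) → Fin n → ℝ)
    (l : ℕ → (Fin n → ℝ) → (Fin m1 → ℝ) → (Fin m2 → ℝ) → ℝ)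
    (lf : (Fin n → ℝ) → ℝ)
    (x : ℕ → Fin n → ℝ) (u1 : ℕ → Fin m1 → ℝ) (u2 : ℕ → Fin m2 → ℝ)
    (pi1 : ℕ → (Fin n → ℝ) → Fin m1 → ℝ) (pi2 : ℕ → (Fin n → ℝ) → Fin m2 → ℝ)
    (lam1 lam2 : ℕ → Fin n → ℝ)
    (a1 b1 : ℕ → Fin m1 → ℝ) (a2 b2 : ℕ → Fin m2 → ℝ)
    (lo1 hi1 : ℕ → Fin m1 → ℝ) (lo2 hi2 : ℕ → Fin m2 → ℝ)
    (hfd : ∀ t, 1 ≤ t → t ≤ K → Differentiable ℝ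
      (fun p : (Fin n → ℝ) × (Fin m1 → ℝ) × (Fin m2 → ℝ) => f t p.1 p.2.1 p.2.2))
    (hld : ∀ t, 1 ≤ t → t ≤ K → Differentiable ℝ
      (fun p : (Fin n → ℝ) × (Fin m1 → ℝ) × (Fin m2 → ℝ) => l t p.1 p.2.1 p.2.2))
    (hlfd : Differentiable ℝ lf)
    (hpi1d : ∀ s, 2 ≤ s → s ≤ K → Differentiable ℝ (pi1 s))
    (hpi2d : ∀ s, 2 ≤ s → s ≤ K → Differentiable ℝ (pi2 s))
    (hdyn : ∀ t, 1 ≤ t → t ≤ K → x (t+1) = f t (x t) (u1 t) (u2 t))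
    (hpc1 : ∀ s, 2 ≤ s → s ≤ K → pi1 s (x s) = u1 s)
    (hpc2 : ∀ s, 2 ≤ s → s ≤ K → pi2 s (x s) = u2 s)
    (hb1 : ∀ t, 1 ≤ t → t ≤ K → ∀ j, a1 t j ≤ u1 t j ∧ u1 t j ≤ b1 t j)
    (hb2 : ∀ t, 1 ≤ t → t ≤ K → ∀ j, a2 t j ≤ u2 t j ∧ u2 t j ≤ b2 t j)
    (hnn1 : ∀ t, 1 ≤ t → t ≤ K → ∀ j, 0 ≤ lo1 t j ∧ 0 ≤ hi1 t j)
    (hnn2 : ∀ t, 1 ≤ t → t ≤ K → ∀ j, 0 ≤ lo2 t j ∧ 0 ≤ hi2 t j)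
    (hcp1 : ∀ t, 1 ≤ t → t ≤ K → ∀ j,
      lo1 t j * (u1 t j - a1 t j) = 0 ∧ hi1 t j * (b1 t j - u1 t j) = 0)
    (hcp2 : ∀ t, 1 ≤ t → t ≤ K → ∀ j,
      lo2 t j * (u2 t j - a2 t j) = 0 ∧ hi2 t j * (b2 t j - u2 t j) = 0)
    (hsc1 : ∀ s, 2 ≤ s → s ≤ K → ∀ j : Fin m1,
      (∀ v, fderiv ℝ (pi1 s) (x s) v j = 0) ∨ (lo1 s j = 0 ∧ hi1 s j = 0))
    (hsc2 : ∀ s, 2 ≤ s → s ≤ K → ∀ j : Fin m2,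
      (∀ v, fderiv ℝ (pi2 s) (x s) v j = 0) ∨ (lo2 s j = 0 ∧ hi2 s j = 0))
    (hOL1a : ∀ t, 2 ≤ t → t ≤ K → grad (fun y => l t y (u1 t) (u2 t)) (x t)
      + jacT (fun y => f t y (u1 t) (u2 t)) (x t) (lam1 t) - lam1 (t-1) = 0)
    (hOL1b : ∀ t, 2 ≤ t → t ≤ K → grad (fun y => -(l t y (u1 t) (u2 t))) (x t)
      + jacT (fun y => f t y (u1 t) (u2 t)) (x t) (lam2 t) - lam2 (t-1) = 0)
    (hOL2a : ∀ t, 1 ≤ t → t ≤ K → grad (fun w => l t (x t) w (u2 t)) (u1 t)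
      + jacT (fun w => f t (x t) w (u2 t)) (u1 t) (lam1 t) - lo1 t + hi1 t = 0)
    (hOL2b : ∀ t, 1 ≤ t → t ≤ K → grad (fun w => -(l t (x t) (u1 t) w)) (u2 t)
      + jacT (fun w => f t (x t) (u1 t) w) (u2 t) (lam2 t) - lo2 t + hi2 t = 0)
    (hOL3a : grad lf (x (K+1)) - lam1 K = 0)
    (hOL3b : grad (fun y => -(lf y)) (x (K+1)) - lam2 K = 0)
 :
    (∀ t, 1 ≤ t → t ≤ K → lam2 t = -lam1 t) ∧
    (∀ s, 2 ≤ s → s ≤ K → grad (fun w => l s (x s) (u1 s) w) (u2 s)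
      + jacT (fun w => f s (x s) (u1 s) w) (u2 s) (lam1 s) - (hi2 s - lo2 s) = 0) ∧
    (∀ s, 2 ≤ s → s ≤ K → grad (fun w => -(l s (x s) w (u2 s))) (u1 s)
      + jacT (fun w => f s (x s) w (u2 s)) (u1 s) (lam2 s) - (hi1 s - lo1 s) = 0) ∧
    (∀ t, 1 ≤ t → t ≤ K → grad (fun w => l t (x t) w (u2 t)) (u1 t)
      + jacT (fun w => f t (x t) w (u2 t)) (u1 t) (lam1 t) - lo1 t + hi1 t = 0) ∧
    (∀ t, 1 ≤ t → t ≤ K → grad (fun w => -(l t (x t) (u1 t) w)) (u2 t)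
      + jacT (fun w => f t (x t) (u1 t) w) (u2 t) (lam2 t) - lo2 t + hi2 t = 0) ∧
    (grad lf (x (K+1)) - lam1 K = 0) ∧
    (grad (fun y => -(lf y)) (x (K+1)) - lam2 K = 0) ∧
    (∀ s, 2 ≤ s → s ≤ K → grad (fun y => l s y (u1 s) (u2 s)) (x s) - lam1 (s-1)
      + jacT (fun y => f s y (u1 s) (u2 s)) (x s) (lam1 s)
      + jacT (pi2 s) (x s) (hi2 s - lo2 s) = 0) ∧
    (∀ s, 2 ≤ s → s ≤ K → grad (fun y => -(l s y (u1 s) (u2 s))) (x s) - lam2 (s-1)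
      + jacT (fun y => f s y (u1 s) (u2 s)) (x s) (lam2 s)
      + jacT (pi1 s) (x s) (hi1 s - lo1 s) = 0) := by
  simp only [grad_neg] at hOL1b hOL2b hOL3b ⊢
  have lam_neg : ∀ d t, 1 ≤ t → t + d = K → lam2 t = -lam1 t := by
    intro d
    induction d with
    | zero =>
      rintro t - rfl
      linear_combination -hOL3a - hOL3b
    | succ d ih =>
      intro t ht htd
      have ha := hOL1a (t + 1) (by omega) (by omega)
      have hb := hOL1b (t + 1) (by omega) (by omega)
      rw [ih (t + 1) (by omega) (by omega), jacT_neg] at hb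
      rw [Nat.add_sub_cancel] at ha hb
      linear_combination -ha - hb
  have hlam : ∀ t, 1 ≤ t → t ≤ K → lam2 t = -lam1 t := fun t ht htK =>
    lam_neg (K - t) t ht (by omega)
  refine ⟨hlam, fun s hs hsK => ?_, fun s hs hsK => ?_, hOL2a, hOL2b, hOL3a, hOL3b,
    fun s hs hsK => ?_, fun s hs hsK => ?_⟩
  · have h := hOL2b s (by omega) hsK
    rw [hlam s (by omega) hsK, jacT_neg] at h
    linear_combination -h
  · have h := hOL2a s (by omega) hsK
    rw [hlam s (by omega) hsK, jacT_neg]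
    linear_combination -h
  · rw [jacT_eq_zero fun i => (hsc2 s hs hsK i).imp_right fun h => by simp [h.1, h.2]]
    linear_combination hOL1a s hs hsK
  · rw [jacT_eq_zero fun i => (hsc1 s hs hsK i).imp_right fun h => by simp [h.1, h.2]]
    linear_combination hOL1b s hs hsK
end
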